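/- Let F = ℚ(q,d₁,d₄,Λ,x) be the field of rational functions over ℚ in the indeterminates q, d₁, d₄, Λ, x. Let m, n ∈ ℕ. For integers i, j with −n ≤ i, j ≤ m define r_{i,j}(Λ) := q^{−in} (Λ d₄)^{i+n} q^{j} Λ^{−j−n} · Σ_{k=max(i, m−n−j)}^{m} r^{UW}_{i,k} · r^{WV}_{k,j}, where r^{UW}_{i,k} := q^{(i−k)(2m+1+i−k)/2} (−d₄)^{k−i} (q;q)_{m−i}/((q;q)_{k−i}(q;q)_{m−k}) · (d₁Λq^{i−k−n};q)_{k−i}(d₁d₄Λq^{−m−n−1};q)_{m−k}/(d₄q^{−m};q)_{m−i} and r^{WV}_{k,j} := q^{(j−k−m−n−1)(j+k−m+n)/2} (−Λ)^{j+k−m+n} (q;q)_{k+n}/((q;q)_{k+j−m+n}(q;q)_{m−j}) · (q^{m+1}/(d₄Λ);q)_{k+j−m+n}(q^{j+1}/d₄;q)_{m−j}/(q^{−k−n}Λ;q)_{k+n}. Then for every i with −n ≤ i ≤ m the following identity holds in F: q^{i(i+1)/2} x^{i} (−d₁ q^{i−m} x;q)_{m−i} (−d₄ q^{−i−n} Λ/x;q)_{i+n}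 = Σ_{j=−n}^{m} r_{i,j}(Λ) · q^{−j(j+1)/2} x^{j} (−q^{−m} x;q)_{m−j} (−q^{−n} Λ/x;q)_{j+n}. -/

import Mathlib

open Finset

/-- The `q`-shifted factorial `(a;q)_n = ∏_{i=0}^{n-1} (1 - a q^i)`. -/
noncomputable def qPoch {F : Type*} [Field F] (q a : F) (n : ℕ) : F :=
  ∏ i ∈ Finset.range n, (1 - a * q ^ i)

/-- The transition coefficient `r^{UW}_{i,k}` of Section 2.1. -/
noncomputable def rUW {F : Type*} [Field F] (q d₁ d₄ Λ : F) (m n : ℕ) (i k : ℤ) : F :=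
  q ^ ((i - k) * (2 * (m : ℤ) + 1 + i - k) / 2) * (-d₄) ^ (k - i).toNat *
    (qPoch q q ((m : ℤ) - i).toNat /
      (qPoch q q (k - i).toNat * qPoch q q ((m : ℤ) - k).toNat)) *
    (qPoch q (d₁ * Λ * q ^ (i - k - (n : ℤ))) (k - i).toNat *
      qPoch q (d₁ * d₄ * Λ * q ^ (-(m : ℤ) - (n : ℤ) - 1)) ((m : ℤ) - k).toNat /
      qPoch q (d₄ * q ^ (-(m : ℤ))) ((m : ℤ) - i).toNat)

/-- The transition coefficient `r^{WV}_{k,j}` of Section 2.1. -/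
noncomputable def rWV {F : Type*} [Field F] (q d₄ Λ : F) (m n : ℕ) (k j : ℤ) : F :=
  q ^ ((j - k - (m : ℤ) - (n : ℤ) - 1) * (j + k - (m : ℤ) + (n : ℤ)) / 2) *
    (-Λ) ^ (j + k - (m : ℤ) + (n : ℤ)).toNat *
    (qPoch q q (k + (n : ℤ)).toNat /
      (qPoch q q (k + j - (m : ℤ) + (n : ℤ)).toNat * qPoch q q ((m : ℤ) - j).toNat)) *
    (qPoch q (q ^ ((m : ℤ) + 1) / (d₄ * Λ)) (k + j - (m : ℤ) + (n : ℤ)).toNat *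
      qPoch q (q ^ (j + 1) / d₄) ((m : ℤ) - j).toNat /
      qPoch q (q ^ (-k - (n : ℤ)) * Λ) (k + (n : ℤ)).toNat)

/-- The matrix entry `r_{i,j}(Λ)` of Section 2.1 (the `R`-matrix of Theorem 2.2). -/
noncomputable def rMat {F : Type*} [Field F] (q d₁ d₄ Λ : F) (m n : ℕ) (i j : ℤ) : F :=
  q ^ (-(i * (n : ℤ))) * (Λ * d₄) ^ (i + (n : ℤ)) * q ^ j * Λ ^ (-(j + (n : ℤ))) *
    ∑ k ∈ Finset.Icc (max i ((m : ℤ) - (n : ℤ) - j)) (m : ℤ),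
      rUW q d₁ d₄ Λ m n i k * rWV q d₄ Λ m n k j

/-- The field `F = ℚ(q,d₁,d₄,Λ,x)` of rational functions over `ℚ` in five indeterminates. -/
noncomputable abbrev F3 : Type := FractionRing (MvPolynomial (Fin 5) ℚ)

section QPochhammerExpansion

variable {F : Type*} [Field F]

lemma qPoch_succ (q a : F) (n : ℕ) : qPoch q a (n + 1) = qPoch q a n * (1 - a * q ^ n) :=
  Finset.prod_range_succ _ _

lemma qPoch_self_ne_zero {q : F} (hq : ∀ l : ℕ, 1 - q ^ (l + 1) ≠ 0) (n : ℕ) :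
    qPoch q q n ≠ 0 :=
  Finset.prod_ne_zero_iff.2 fun l _ => by simpa [pow_succ'] using hq l

/-- The `s`-th term of the expansion `prod_mul_prod_eq_sum_expansionTerm`. -/
noncomputable def expansionTerm (q u v d A B : F) (s r : ℕ) : F :=
  qPoch q q (s + r) / (qPoch q q s * qPoch q q r) *
    (∏ l ∈ range s, (q ^ l - d * B)) * (∏ l ∈ range r, (d * A - q ^ (s + l))) *
    (∏ l ∈ range s, (v * q ^ l + A * u)) * ∏ l ∈ range r, (v + B * u * q ^ l)

lemma expansionTerm_zero_succ {q : F} (hq : ∀ l : ℕ, 1 - q ^ (l + 1) ≠ 0) (u v d A B : F)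
    (r : ℕ) :
    expansionTerm q u v d A B 0 (r + 1) =
      (d * A - q ^ r) * (v + B * u * q ^ r) * expansionTerm q u v d A B 0 r := by
  have h1 := qPoch_self_ne_zero hq r
  have h2 := qPoch_self_ne_zero hq (r + 1)
  simp only [expansionTerm, zero_add, prod_range_succ]
  simp [qPoch] at h1 h2 ⊢
  field_simp

lemma expansionTerm_succ_zero {q : F} (hq : ∀ l : ℕ, 1 - q ^ (l + 1) ≠ 0) (u v d A B : F)
    (s : ℕ) :
    expansionTerm q u v d A B (s + 1) 0 =
      (q ^ s - d * B) * (v * q ^ s + A * u) * expansionTerm q u v d A B s 0 := by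
  have h1 := qPoch_self_ne_zero hq s
  have h2 := qPoch_self_ne_zero hq (s + 1)
  have h0 : qPoch q q 0 = 1 := rfl
  simp only [expansionTerm, add_zero, prod_range_succ, prod_range_zero, h0]
  field_simp

lemma expansionTerm_succ_succ {q : F} (hq : ∀ l : ℕ, 1 - q ^ (l + 1) ≠ 0) (u v d A B : F)
    (s r : ℕ) :
    expansionTerm q u v d A B (s + 1) (r + 1) =
      q ^ (r + 1) * (q ^ s - d * B) * (v * q ^ s + A * u) * expansionTerm q u v d A B s (r + 1) +
      (d * A - q ^ (s + r + 1 + (s + 1))) * (v + B * u * q ^ r) *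
        expansionTerm q u v d A B (s + 1) r := by
  have h1 := qPoch_self_ne_zero hq s
  have h2 := qPoch_self_ne_zero hq r
  have e1 : s + 1 + (r + 1) = s + r + 1 + 1 := by ring
  have e2 : s + (r + 1) = s + r + 1 := by ring
  have e3 : s + 1 + r = s + r + 1 := by ring
  have e4 : ∏ l ∈ range (r + 1), (d * A - q ^ (s + 1 + l)) =
      (∏ l ∈ range r, (d * A - q ^ (s + 1 + l))) * (d * A - q ^ (s + r + 1)) := by
    rw [prod_range_succ, e3]
  have e5 : ∏ l ∈ range (r + 1), (d * A - q ^ (s + l)) =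
      (∏ l ∈ range r, (d * A - q ^ (s + 1 + l))) * (d * A - q ^ s) := by
    rw [prod_range_succ']
    congr 1
    exact prod_congr rfl fun l _ => by rw [add_right_comm s 1 l, add_assoc s l 1]
  have h3 := hq s
  have h4 := hq r
  have h5 : ∀ l : ℕ, 1 - q * q ^ l ≠ 0 := fun l => by simpa [pow_succ'] using hq l
  have h6 := h5 s
  have h7 := h5 r
  simp only [expansionTerm, e1, e2, e3, e4, e5, prod_range_succ _ s, prod_range_succ _ r,
    qPoch_succ q q (s + r + 1), qPoch_succ q q s, qPoch_succ q q r]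
  field_simp
  ring

/-- The induction step of `prod_mul_prod_eq_sum_expansionTerm`. -/
lemma sum_expansionTerm_succ {q : F} (hq : ∀ l : ℕ, 1 - q ^ (l + 1) ≠ 0) (u v d A B : F)
    (p : ℕ) :
    ∑ s ∈ range (p + 2), expansionTerm q u v d A B s (p + 1 - s) =
      (A - B * q ^ p) * (u * q ^ p + d * v) *
        ∑ s ∈ range (p + 1), expansionTerm q u v d A B s (p - s) := by
  set T := expansionTerm q u v d A B with hT
  have hsplit : ∀ s ∈ range (p + 1),
      (A - B * q ^ p) * (u * q ^ p + d * v) * T s (p - s) =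
        q ^ (p - s) * (q ^ s - d * B) * (v * q ^ s + A * u) * T s (p - s) +
        (d * A - q ^ (p + s)) * (v + B * u * q ^ (p - s)) * T s (p - s) := by
    intro s hs
    obtain ⟨r, rfl⟩ := Nat.exists_eq_add_of_le (Nat.lt_succ_iff.1 (mem_range.1 hs))
    rw [Nat.add_sub_cancel_left]
    ring
  rw [mul_sum, sum_congr rfl hsplit, sum_add_distrib, sum_range_succ' _ (p + 1),
    sum_range_succ _ p, sum_range_succ _ p, sum_range_succ' _ p]
  have hmid : ∀ s ∈ range p, T (s + 1) (p + 1 - (s + 1)) =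
      q ^ (p - s) * (q ^ s - d * B) * (v * q ^ s + A * u) * T s (p - s) +
      (d * A - q ^ (p + (s + 1))) * (v + B * u * q ^ (p - (s + 1))) *
        T (s + 1) (p - (s + 1)) := by
    intro s hs
    obtain ⟨r, rfl⟩ := Nat.exists_eq_add_of_lt (mem_range.1 hs)
    have e1 : s + r + 1 + 1 - (s + 1) = r + 1 := by omega
    have e2 : s + r + 1 - s = r + 1 := by omega
    have e3 : s + r + 1 - (s + 1) = r := by omega
    rw [e1, e2, e3]
    exact expansionTerm_succ_succ hq u v d A B s r
  have hlast : T (p + 1) (p + 1 - (p + 1)) =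
      q ^ (p - p) * (q ^ p - d * B) * (v * q ^ p + A * u) * T p (p - p) := by
    simp only [Nat.sub_self, pow_zero, one_mul]
    exact expansionTerm_succ_zero hq u v d A B p
  have hfirst : T 0 (p + 1 - 0) =
      (d * A - q ^ (p + 0)) * (v + B * u * q ^ (p - 0)) * T 0 (p - 0) :=
    expansionTerm_zero_succ hq u v d A B p
  rw [sum_congr rfl hmid, sum_add_distrib, hlast, hfirst]
  ring

/-- Expansion of a product of `p` linear forms in `u, v` along a `q`-geometric progression in
products of two other such families. -/
theorem prod_mul_prod_eq_sum_expansionTerm {q : F} (hq : ∀ l : ℕ, 1 - q ^ (l + 1) ≠ 0)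
    (u v d A B : F) (p : ℕ) :
    (∏ l ∈ range p, (A - B * q ^ l)) * ∏ l ∈ range p, (u * q ^ l + d * v) =
      ∑ s ∈ range (p + 1), expansionTerm q u v d A B s (p - s) := by
  induction p with
  | zero => simp [expansionTerm, qPoch]
  | succ p ih =>
    rw [sum_expansionTerm_succ hq, ← ih, prod_range_succ, prod_range_succ]
    ring

end QPochhammerExpansion

section BasisChange

variable {F : Type*} [Field F]

/-- The triangular number `0 + 1 + ⋯ + (n - 1)`. -/
def tri (n : ℕ) : ℤ := (n : ℤ) * (n - 1) / 2

lemma two_mul_tri (n : ℕ) : 2 * tri n = (n : ℤ) * (n - 1) := by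
  have : (2 : ℤ) ∣ (n : ℤ) * (n - 1) := by
    simpa using (Int.even_mul_pred_self (n : ℤ)).two_dvd
  rw [tri]
  exact Int.mul_ediv_cancel' this

lemma two_mul_ediv_two_mul_succ (i : ℤ) : 2 * (i * (i + 1) / 2) = i * (i + 1) :=
  Int.mul_ediv_cancel' (Int.even_mul_succ_self i).two_dvd

lemma tri_succ (n : ℕ) : tri (n + 1) = tri n + n := by
  have h1 := two_mul_tri n
  have h2 := two_mul_tri (n + 1)
  push_cast at h2
  linarith

lemma prod_mul_pow_mul {q : F} (hq0 : q ≠ 0) (c : F) (f : ℕ → F) (n : ℕ) :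
    ∏ l ∈ range n, (c * q ^ l * f l) = c ^ n * q ^ tri n * ∏ l ∈ range n, f l := by
  induction n with
  | zero => simp [tri]
  | succ n ih =>
    rw [prod_range_succ, prod_range_succ, ih, tri_succ, zpow_add₀ hq0, zpow_natCast]
    ring

lemma pow_mul_prod_range (c : F) (f : ℕ → F) (n : ℕ) :
    c ^ n * ∏ l ∈ range n, f l = ∏ l ∈ range n, (c * f l) := by
  rw [prod_mul_distrib, prod_const, card_range]

lemma qPoch_reflect {q : F} (hq0 : q ≠ 0) (a : F) (n : ℕ) :
    qPoch q (a * q ^ (1 - (n : ℤ))) n = ∏ l ∈ range n, (1 - a * q ^ (-(l : ℤ))) := by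
  rw [qPoch, ← prod_range_reflect]
  refine prod_congr rfl fun l hl => ?_
  have hl := mem_range.1 hl
  rw [mul_assoc, ← zpow_natCast, ← zpow_add₀ hq0]
  congr 3
  omega

lemma qPoch_reflect' {q : F} (hq0 : q ≠ 0) (a : F) (n : ℕ) :
    qPoch q (a * q ^ (1 - (n : ℤ))) n = q ^ (-tri n) * ∏ l ∈ range n, (q ^ l - a) := by
  have h : ∏ l ∈ range n, (q ^ l - a) = ∏ l ∈ range n, (1 * q ^ l * (1 - a * q ^ (-(l : ℤ)))) := by
    refine prod_congr rfl fun l _ => ?_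
    rw [zpow_neg, zpow_natCast]
    field_simp
  rw [h, prod_mul_pow_mul hq0, qPoch_reflect hq0, zpow_neg, one_pow, one_mul,
    inv_mul_cancel_left₀ (zpow_ne_zero _ hq0)]

/-- The product `∏_{l=1}^{K} (x + d₄ Λ q^{-l})`. -/
noncomputable def prodP (q d₄ Λ x : F) (K : ℕ) : F :=
  ∏ l ∈ range K, (x + d₄ * Λ * q ^ (-((l : ℤ) + 1)))

/-- The product `∏_{l=0}^{R-1} (x + Λ q^{l-n})`. -/
noncomputable def prodQ (q Λ x : F) (n R : ℕ) : F :=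
  ∏ l ∈ range R, (x + Λ * q ^ (-(n : ℤ)) * q ^ l)

/-- The intermediate basis between the two sides of the `R`-matrix relation, up to the index
shift `k = K - n` and with `R = m + n - K`. -/
noncomputable def wBasis (q d₄ Λ x : F) (m n K R : ℕ) : F :=
  q ^ ((m : ℤ) * K - tri m) * d₄ ^ (-(K : ℤ)) * Λ ^ (-((m : ℤ) + n)) * x ^ (-(n : ℤ)) *
    prodP q d₄ Λ x K * prodQ q Λ x n R

lemma zpow_mul_qPoch_eq_prodP {q x : F} (hq0 : q ≠ 0) (hx0 : x ≠ 0) (d₄ Λ : F) (n I : ℕ) :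
    x ^ ((I : ℤ) - n) * qPoch q (-d₄ * q ^ (-(I : ℤ)) * Λ / x) I =
      x ^ (-(n : ℤ)) * prodP q d₄ Λ x I := by
  have h : -d₄ * q ^ (-(I : ℤ)) * Λ / x = -d₄ * Λ / x * q ^ (-1 : ℤ) * q ^ (1 - (I : ℤ)) := by
    rw [mul_assoc _ (q ^ (-1 : ℤ)), ← zpow_add₀ hq0,
      show (-1 : ℤ) + (1 - (I : ℤ)) = -(I : ℤ) by ring]
    ring
  rw [h, qPoch_reflect hq0, sub_eq_neg_add, zpow_add₀ hx0, zpow_natCast, mul_assoc, prodP]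
  congr 1
  rw [pow_mul_prod_range]
  refine prod_congr rfl fun l _ => ?_
  rw [neg_add_rev, zpow_add₀ hq0]
  field_simp
  ring

lemma zpow_mul_qPoch_eq_prodQ {q x : F} (hx0 : x ≠ 0) (Λ : F) (n J : ℕ) :
    x ^ ((J : ℤ) - n) * qPoch q (-(q ^ (-(n : ℤ))) * Λ / x) J =
      x ^ (-(n : ℤ)) * prodQ q Λ x n J := by
  rw [sub_eq_neg_add, zpow_add₀ hx0, zpow_natCast, mul_assoc, prodQ, qPoch]
  congr 1
  rw [pow_mul_prod_range]
  refine prod_congr rfl fun l _ => ?_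
  field_simp
  ring

lemma prodP_add {q : F} (hq0 : q ≠ 0) (d₄ Λ x : F) (I s : ℕ) :
    prodP q d₄ Λ x (I + s) = prodP q d₄ Λ x I * (q ^ (-tri s) *
      ∏ l ∈ range s, (x * q ^ l + d₄ * Λ * q ^ (-(I : ℤ) - 1) * 1)) := by
  have h : ∏ l ∈ range s, (x * q ^ l + d₄ * Λ * q ^ (-(I : ℤ) - 1) * 1) =
      ∏ l ∈ range s, (1 * q ^ l * (x + d₄ * Λ * q ^ (-(((I + l : ℕ) : ℤ) + 1)))) := by
    refine prod_congr rfl fun l _ => ?_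
    rw [show -(((I + l : ℕ) : ℤ) + 1) = (-(I : ℤ) - 1) - l by push_cast; ring,
      zpow_sub₀ hq0 _ (l : ℤ), zpow_natCast]
    field_simp
  rw [h, prod_mul_pow_mul hq0, one_pow, one_mul, zpow_neg,
    inv_mul_cancel_left₀ (zpow_ne_zero _ hq0), prodP, prod_range_add, prodP]

/-- Explicit form of `rUW` in terms of the products appearing in `expansionTerm`. -/
lemma rUW_eq {q : F} (hq0 : q ≠ 0) (d₁ d₄ Λ : F) (m n I s r : ℕ) (h : I + (s + r) = m + n) :
    rUW q d₁ d₄ Λ m n ((I : ℤ) - n) ((I : ℤ) - n + s) =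
      q ^ (tri s - s * m) * ((-1) ^ s * d₄ ^ s) *
        (qPoch q q (s + r) / (qPoch q q s * qPoch q q r)) *
        (q ^ (-tri s) * ∏ l ∈ range s, (q ^ l - d₁ * q ^ (-1 : ℤ) * (Λ * q ^ (-(n : ℤ))))) *
        ((-1) ^ r * q ^ (-(tri r + s * r)) *
          ∏ l ∈ range r,
            (d₁ * q ^ (-1 : ℤ) * (d₄ * Λ * q ^ (-(I : ℤ) - 1)) - q ^ (s + l))) *
        (qPoch q (d₄ * q ^ (-(m : ℤ))) (s + r))⁻¹ := by
  have hs := two_mul_tri s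
  have e1 : ((I : ℤ) - n - ((I : ℤ) - n + s)) *
      (2 * (m : ℤ) + 1 + ((I : ℤ) - n) - ((I : ℤ) - n + s)) / 2 = tri s - s * m := by
    refine Int.ediv_eq_of_eq_mul_right two_ne_zero ?_
    linear_combination -hs
  have e2 : ((I : ℤ) - n + s - ((I : ℤ) - n)).toNat = s := by omega
  have e3 : ((m : ℤ) - ((I : ℤ) - n)).toNat = s + r := by omega
  have e4 : ((m : ℤ) - ((I : ℤ) - n + s)).toNat = r := by omega
  have p1 : d₁ * Λ * q ^ ((I : ℤ) - n - ((I : ℤ) - n + s) - n) =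
      d₁ * q ^ (-1 : ℤ) * (Λ * q ^ (-(n : ℤ))) * q ^ (1 - (s : ℤ)) := by
    rw [show (I : ℤ) - n - ((I : ℤ) - n + s) - n = -1 + -(n : ℤ) + (1 - s) by ring,
      zpow_add₀ hq0, zpow_add₀ hq0]
    ring
  have p2 : d₁ * d₄ * Λ * q ^ (-(m : ℤ) - n - 1) =
      d₁ * q ^ (-1 : ℤ) * (d₄ * Λ * q ^ (-(I : ℤ) - 1)) * q ^ (-(s : ℤ)) * q ^ (1 - (r : ℤ)) := by
    rw [show -(m : ℤ) - n - 1 = -1 + (-(I : ℤ) - 1) + -(s : ℤ) + (1 - r) by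
      have : (I : ℤ) + (s + r) = m + n := by exact_mod_cast h
      linarith,
      zpow_add₀ hq0, zpow_add₀ hq0, zpow_add₀ hq0]
    ring
  have p3 : ∀ a : F, ∏ l ∈ range r, (q ^ l - a * q ^ (-(s : ℤ))) =
      (-1) ^ r * q ^ (-((s : ℤ) * r)) * ∏ l ∈ range r, (a - q ^ (s + l)) := by
    intro a
    have : (-1) ^ r * q ^ (-((s : ℤ) * r)) = ∏ _l ∈ range r, (-1 * q ^ (-(s : ℤ))) := by
      rw [prod_const, card_range, mul_pow, ← zpow_natCast (q ^ (-(s : ℤ))), ← zpow_mul, neg_mul]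
    rw [this, ← prod_mul_distrib]
    refine prod_congr rfl fun l _ => ?_
    rw [zpow_neg, zpow_natCast, pow_add]
    field_simp
    ring
  rw [rUW, e1, e2, e3, e4, p1, p2, qPoch_reflect' hq0, qPoch_reflect' hq0, p3, neg_pow,
    neg_add, zpow_add₀ hq0 (-tri r)]
  ring

/-- Explicit form of `rWV` in terms of the products appearing in `expansionTerm`. -/
lemma rWV_eq {q d₄ Λ : F} (hq0 : q ≠ 0) (hd : d₄ ≠ 0) (hΛ : Λ ≠ 0) (m n t r : ℕ) :
    rWV q d₄ Λ m n ((t : ℤ) + r - n) ((m : ℤ) - r) =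
      q ^ (tri t - t * (t + r)) * ((-1) ^ t * Λ ^ t) *
        (qPoch q q (t + r) / (qPoch q q t * qPoch q q r)) *
        ((-1) ^ t * (d₄ * Λ) ^ (-(t : ℤ)) * q ^ (((m : ℤ) + 1) * t) *
          ∏ l ∈ range t, (q ^ l - d₄ * Λ * q ^ (-(m : ℤ) - 1))) *
        (d₄ ^ (-(r : ℤ)) * q ^ (-(((t : ℤ) + r - m - 1) * r)) *
          ∏ l ∈ range r, (d₄ * Λ * (q ^ ((t : ℤ) + r - m - 1) * Λ⁻¹) - q ^ (t + l))) *
        (qPoch q (q ^ (-((t : ℤ) + r)) * Λ) (t + r))⁻¹ := by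
  have ht := two_mul_tri t
  have e1 : ((m : ℤ) - r - ((t : ℤ) + r - n) - m - n - 1) *
      ((m : ℤ) - r + ((t : ℤ) + r - n) - m + n) / 2 = tri t - t * (t + r) := by
    refine Int.ediv_eq_of_eq_mul_right two_ne_zero ?_
    linear_combination -ht
  have e2 : ((m : ℤ) - r + ((t : ℤ) + r - n) - m + n).toNat = t := by omega
  have e3 : ((t : ℤ) + r - n + n).toNat = t + r := by omega
  have e4 : ((t : ℤ) + r - n + ((m : ℤ) - r) - m + n).toNat = t := by omega
  have e5 : ((m : ℤ) - ((m : ℤ) - r)).toNat = r := by omega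
  have e6 : -((t : ℤ) + r - n) - n = -((t : ℤ) + r) := by ring
  have p1 : qPoch q (q ^ ((m : ℤ) + 1) / (d₄ * Λ)) t =
      (-1) ^ t * (d₄ * Λ) ^ (-(t : ℤ)) * q ^ (((m : ℤ) + 1) * t) *
        ∏ l ∈ range t, (q ^ l - d₄ * Λ * q ^ (-(m : ℤ) - 1)) := by
    have : (-1) ^ t * (d₄ * Λ) ^ (-(t : ℤ)) * q ^ (((m : ℤ) + 1) * t) =
        (-1 * (d₄ * Λ)⁻¹ * q ^ ((m : ℤ) + 1)) ^ t := by
      rw [mul_pow, mul_pow, ← zpow_natCast (q ^ ((m : ℤ) + 1)), ← zpow_mul, zpow_neg,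
        zpow_natCast, inv_pow]
    rw [this, pow_mul_prod_range, qPoch]
    refine prod_congr rfl fun l _ => ?_
    rw [show -(m : ℤ) - 1 = -((m : ℤ) + 1) by ring, zpow_neg]
    have := zpow_ne_zero ((m : ℤ) + 1) hq0
    field_simp
    ring
  have p2 : qPoch q (q ^ ((m : ℤ) - r + 1) / d₄) r =
      d₄ ^ (-(r : ℤ)) * q ^ (-(((t : ℤ) + r - m - 1) * r)) *
        ∏ l ∈ range r, (d₄ * Λ * (q ^ ((t : ℤ) + r - m - 1) * Λ⁻¹) - q ^ (t + l)) := by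
    have : d₄ ^ (-(r : ℤ)) * q ^ (-(((t : ℤ) + r - m - 1) * r)) =
        (d₄⁻¹ * q ^ (-((t : ℤ) + r - m - 1))) ^ r := by
      rw [mul_pow, ← zpow_natCast (q ^ (-((t : ℤ) + r - m - 1))), ← zpow_mul, zpow_neg,
        zpow_natCast, inv_pow, neg_mul]
    rw [this, pow_mul_prod_range, qPoch]
    refine prod_congr rfl fun l _ => ?_
    rw [show (m : ℤ) - r + 1 = t - ((t : ℤ) + r - m - 1) by ring, zpow_sub₀ hq0, zpow_neg,
      zpow_natCast, pow_add]
    have := zpow_ne_zero ((t : ℤ) + r - m - 1) hq0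
    field_simp
  rw [rWV, e1, e2, e3, e4, e5, e6, p1, p2, neg_pow]
  ring

/-- Expansion of the left-hand side of the `R`-matrix relation in the intermediate basis. -/
lemma lhs_eq_sum_rUW_mul_wBasis {q d₄ Λ x : F} (hq0 : q ≠ 0)
    (hq : ∀ l : ℕ, 1 - q ^ (l + 1) ≠ 0) (hd0 : d₄ ≠ 0) (hΛ0 : Λ ≠ 0) (hx0 : x ≠ 0)
    (hd : ∀ z : ℤ, 1 - d₄ * q ^ z ≠ 0) (d₁ : F) (m n I p : ℕ) (h : I + p = m + n) :
    q ^ (((I : ℤ) - n) * ((I : ℤ) - n + 1) / 2) * x ^ ((I : ℤ) - n) *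
        qPoch q (-d₁ * q ^ (-(p : ℤ)) * x) p *
        qPoch q (-d₄ * q ^ (-(I : ℤ)) * Λ / x) I =
      q ^ (-(((I : ℤ) - n) * n)) * (Λ * d₄) ^ (I : ℤ) *
        ∑ s ∈ range (p + 1), rUW q d₁ d₄ Λ m n ((I : ℤ) - n) ((I : ℤ) - n + s) *
          wBasis q d₄ Λ x m n (I + s) (p - s) := by
  have core := prod_mul_prod_eq_sum_expansionTerm hq 1 x (d₁ * q ^ (-1 : ℤ))
    (d₄ * Λ * q ^ (-(I : ℤ) - 1)) (Λ * q ^ (-(n : ℤ))) p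
  set E := ((I : ℤ) - n) * ((I : ℤ) - n + 1) / 2 with hE
  have hE2 := two_mul_ediv_two_mul_succ ((I : ℤ) - n)
  rw [← hE] at hE2
  have hI : (I : ℤ) + p = m + n := by exact_mod_cast h
  set H := qPoch q (d₄ * q ^ (-(m : ℤ))) p with hH
  have hH0 : H ≠ 0 := by
    refine prod_ne_zero_iff.2 fun l _ => ?_
    rw [mul_assoc, ← zpow_natCast, ← zpow_add₀ hq0]
    exact hd _
  have hD : ∏ l ∈ range p, (d₄ * Λ * q ^ (-(I : ℤ) - 1) - Λ * q ^ (-(n : ℤ)) * q ^ l) =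
      (-1) ^ p * Λ ^ p * q ^ (tri p - n * p) * H := by
    have e : d₄ * q ^ (-(m : ℤ)) = d₄ * q ^ ((n : ℤ) - I - 1) * q ^ (1 - (p : ℤ)) := by
      rw [mul_assoc, ← zpow_add₀ hq0]
      congr 2
      linarith
    have e2 : (-1) ^ p * Λ ^ p * q ^ (tri p - n * p) * q ^ (-tri p) =
        (-1 * Λ * q ^ (-(n : ℤ))) ^ p := by
      rw [mul_assoc, ← zpow_add₀ hq0, mul_pow, mul_pow, ← zpow_natCast (q ^ (-(n : ℤ))),
        ← zpow_mul]
      congr 2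
      ring
    rw [hH, e, qPoch_reflect' hq0, ← mul_assoc, e2, pow_mul_prod_range]
    refine prod_congr rfl fun l _ => ?_
    rw [show -(I : ℤ) - 1 = -n + ((n : ℤ) - I - 1) by ring, zpow_add₀ hq0]
    ring
  have hL : qPoch q (-d₁ * q ^ (-(p : ℤ)) * x) p =
      q ^ (-tri p) * ∏ l ∈ range p, (1 * q ^ l + d₁ * q ^ (-1 : ℤ) * x) := by
    have e : -d₁ * q ^ (-(p : ℤ)) * x = -d₁ * q ^ (-1 : ℤ) * x * q ^ (1 - (p : ℤ)) := by
      rw [show -(p : ℤ) = -1 + (1 - (p : ℤ)) by ring, zpow_add₀ hq0]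
      ring
    rw [e, qPoch_reflect' hq0]
    congr 1
    exact prod_congr rfl fun l _ => by ring
  have hterm : ∀ s ∈ range (p + 1),
      q ^ (-(((I : ℤ) - n) * n)) * (Λ * d₄) ^ (I : ℤ) *
        (rUW q d₁ d₄ Λ m n ((I : ℤ) - n) ((I : ℤ) - n + s) *
          wBasis q d₄ Λ x m n (I + s) (p - s)) =
      q ^ E * q ^ (-tri p) * x ^ (-(n : ℤ)) * prodP q d₄ Λ x I *
        ((-1) ^ p * Λ ^ p * q ^ (tri p - n * p) * H)⁻¹ *
        expansionTerm q 1 x (d₁ * q ^ (-1 : ℤ)) (d₄ * Λ * q ^ (-(I : ℤ) - 1))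
          (Λ * q ^ (-(n : ℤ))) s (p - s) := by
    intro s hs
    obtain ⟨r, rfl⟩ := Nat.exists_eq_add_of_le (Nat.lt_succ_iff.1 (mem_range.1 hs))
    rw [Nat.add_sub_cancel_left, rUW_eq hq0 d₁ d₄ Λ m n I s r h, wBasis, prodP_add hq0,
      ← hH]
    have hQ : prodQ q Λ x n r =
        ∏ l ∈ range r, (x + Λ * q ^ (-(n : ℤ)) * 1 * q ^ l) := by
      simp only [prodQ, mul_one]
    rw [hQ]
    have hqe : q ^ (-(((I : ℤ) - n) * n)) * q ^ (tri s - s * m) * q ^ (-tri s) *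
        q ^ (-(tri r + s * r)) * q ^ ((m : ℤ) * (I + s : ℕ) - tri m) * q ^ (-tri s) =
        q ^ E * q ^ (-tri (s + r)) * q ^ (-(tri (s + r) - n * (s + r : ℕ))) := by
      simp only [← zpow_add₀ hq0]
      congr 1
      have h1 := two_mul_tri s
      have h2 := two_mul_tri r
      have h3 := two_mul_tri m
      have h4 := two_mul_tri (s + r)
      push_cast at h4 hI ⊢
      have hI' : (I : ℤ) = m + n - s - r := by linarith
      rw [hI'] at hE2 ⊢
      linarith
    have hde : (Λ * d₄) ^ (I : ℤ) * d₄ ^ s * d₄ ^ (-((I + s : ℕ) : ℤ)) *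
        Λ ^ (-((m : ℤ) + n)) = (Λ ^ (s + r))⁻¹ := by
      rw [show (m : ℤ) + n = ((I + (s + r) : ℕ) : ℤ) by exact_mod_cast h.symm, zpow_neg,
        zpow_neg, zpow_natCast, zpow_natCast, zpow_natCast, mul_pow]
      field_simp
      ring
    have hs1 : (-1 : F) ^ s * (-1) ^ r = ((-1) ^ (s + r))⁻¹ := by
      rw [← pow_add, ← inv_pow]
      norm_num
    rw [mul_inv, mul_inv, mul_inv, ← hs1, ← hde, ← zpow_neg]
    linear_combination (norm := skip) ((Λ * d₄) ^ (I : ℤ) * d₄ ^ s * d₄ ^ (-((I + s : ℕ) : ℤ)) *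
        Λ ^ (-((m : ℤ) + n)) * ((-1 : F) ^ s * (-1) ^ r) * x ^ (-(n : ℤ)) *
        prodP q d₄ Λ x I * H⁻¹ * expansionTerm q 1 x (d₁ * q ^ (-1 : ℤ))
          (d₄ * Λ * q ^ (-(I : ℤ) - 1)) (Λ * q ^ (-(n : ℤ))) s r) * hqe
    simp only [expansionTerm]
    ring
  rw [mul_sum, sum_congr rfl hterm, ← mul_sum, ← core, hD, hL]
  have hP := zpow_mul_qPoch_eq_prodP hq0 hx0 d₄ Λ n I
  have hD0 : (-1) ^ p * Λ ^ p * q ^ (tri p - n * p) * H ≠ 0 :=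
    mul_ne_zero (mul_ne_zero (mul_ne_zero (pow_ne_zero _ (by simp)) (pow_ne_zero _ hΛ0))
      (zpow_ne_zero _ hq0)) hH0
  rw [mul_assoc _ (_ * H)⁻¹, inv_mul_cancel_left₀ hD0]
  linear_combination (q ^ E * q ^ (-tri p) *
    ∏ l ∈ range p, (1 * q ^ l + d₁ * q ^ (-1 : ℤ) * x)) * hP

lemma prodQ_add {q Λ : F} (hq0 : q ≠ 0) (hΛ0 : Λ ≠ 0) (x : F) (m n R t r : ℕ)
    (h : R + (t + r) = m + n) :
    prodQ q Λ x n (R + t) = prodQ q Λ x n R * (q ^ (-(((t : ℤ) + r - m) * t)) * Λ ^ t *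
      ∏ l ∈ range t, (1 * q ^ l + q ^ ((t : ℤ) + r - m - 1) * Λ⁻¹ * (x * q))) := by
  have h' : (R : ℤ) + (t + r) = m + n := by exact_mod_cast h
  have : q ^ (-(((t : ℤ) + r - m) * t)) * Λ ^ t = (q ^ (-((t : ℤ) + r - m)) * Λ) ^ t := by
    rw [mul_pow, ← zpow_natCast (q ^ (-((t : ℤ) + r - m))), ← zpow_mul, neg_mul]
  rw [prodQ, prod_range_add, prodQ, this, pow_mul_prod_range]
  congr 1
  refine prod_congr rfl fun l _ => ?_
  rw [show -(n : ℤ) = -((t : ℤ) + r - m) - R by linarith, zpow_sub₀ hq0, zpow_natCast, pow_add,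
    zpow_sub_one₀ hq0, zpow_neg]
  have := zpow_ne_zero ((t : ℤ) + r - m) hq0
  field_simp
  ring

/-- The right-hand basis of the `R`-matrix relation, with the `j`-dependent prefactor of `rMat`
absorbed. -/
noncomputable def vBasis (q Λ x : F) (m n : ℕ) (j : ℤ) : F :=
  q ^ j * Λ ^ (-(j + (n : ℤ))) * q ^ (-(j * (j + 1) / 2)) * x ^ j *
    qPoch q (-(q ^ (-(m : ℤ))) * x) ((m : ℤ) - j).toNat *
    qPoch q (-(q ^ (-(n : ℤ))) * Λ / x) (j + (n : ℤ)).toNat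

/-- Expansion of the intermediate basis in the right-hand basis. -/
lemma wBasis_eq_sum_rWV_mul_vBasis {q d₄ Λ x : F} (hq0 : q ≠ 0)
    (hq : ∀ l : ℕ, 1 - q ^ (l + 1) ≠ 0) (hd0 : d₄ ≠ 0) (hΛ0 : Λ ≠ 0) (hx0 : x ≠ 0)
    (hΛ : ∀ z : ℤ, 1 - Λ * q ^ z ≠ 0) (m n K R : ℕ) (h : R + K = m + n) :
    wBasis q d₄ Λ x m n K R =
      ∑ t ∈ range (K + 1), rWV q d₄ Λ m n ((K : ℤ) - n) ((m : ℤ) - K + t) *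
        vBasis q Λ x m n ((m : ℤ) - K + t) := by
  have core := prod_mul_prod_eq_sum_expansionTerm hq (x * q) 1 (d₄ * Λ)
    (q ^ ((K : ℤ) - m - 1) * Λ⁻¹) (q ^ (-(m : ℤ) - 1)) K
  set H := qPoch q (q ^ (-(K : ℤ)) * Λ) K with hH
  have hH0 : H ≠ 0 := by
    refine prod_ne_zero_iff.2 fun l _ => ?_
    rw [mul_right_comm, ← zpow_natCast, ← zpow_add₀ hq0, mul_comm]
    exact hΛ _
  have hD : ∏ l ∈ range K, (q ^ ((K : ℤ) - m - 1) * Λ⁻¹ - q ^ (-(m : ℤ) - 1) * q ^ l) =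
      q ^ (((K : ℤ) - m - 1) * K) * (Λ ^ K)⁻¹ * H := by
    have : q ^ (((K : ℤ) - m - 1) * K) * (Λ ^ K)⁻¹ = (q ^ ((K : ℤ) - m - 1) * Λ⁻¹) ^ K := by
      rw [mul_pow, ← zpow_natCast (q ^ ((K : ℤ) - m - 1)), ← zpow_mul, inv_pow]
    rw [this, hH, qPoch, pow_mul_prod_range]
    refine prod_congr rfl fun l _ => ?_
    rw [show -(m : ℤ) - 1 = (K : ℤ) - m - 1 + -K by ring, zpow_add₀ hq0 _ (-(K : ℤ))]
    field_simp
  have hP : ∏ l ∈ range K, (x * q * q ^ l + d₄ * Λ * 1) =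
      q ^ (tri (K + 1)) * prodP q d₄ Λ x K := by
    have : ∏ l ∈ range K, (x * q * q ^ l + d₄ * Λ * 1) =
        ∏ l ∈ range K, (q * q ^ l * (x + d₄ * Λ * q ^ (-((l : ℤ) + 1)))) := by
      refine prod_congr rfl fun l _ => ?_
      rw [zpow_neg, zpow_add_one₀ hq0, zpow_natCast]
      field_simp
    rw [this, prod_mul_pow_mul hq0, tri_succ, zpow_add₀ hq0, zpow_natCast, prodP]
    ring
  have hterm : ∀ t ∈ range (K + 1),
      rWV q d₄ Λ m n ((K : ℤ) - n) ((m : ℤ) - K + t) *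
        vBasis q Λ x m n ((m : ℤ) - K + t) =
      q ^ ((m : ℤ) * K - tri m) * d₄ ^ (-(K : ℤ)) * Λ ^ (-((m : ℤ) + n)) * x ^ (-(n : ℤ)) *
        prodQ q Λ x n R * q ^ (-tri (K + 1)) * (q ^ (((K : ℤ) - m - 1) * K) * (Λ ^ K)⁻¹ * H)⁻¹ *
        expansionTerm q (x * q) 1 (d₄ * Λ) (q ^ ((K : ℤ) - m - 1) * Λ⁻¹)
          (q ^ (-(m : ℤ) - 1)) t (K - t) := by
    intro t ht
    obtain ⟨r, rfl⟩ := Nat.exists_eq_add_of_le (Nat.lt_succ_iff.1 (mem_range.1 ht))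
    have hR : (R : ℤ) + (t + r) = m + n := by exact_mod_cast h
    have e1 : (m : ℤ) - (t + r : ℕ) + t = m - r := by push_cast; ring
    have e2 : ((m : ℤ) - (m - r)).toNat = r := by omega
    have e3 : ((m : ℤ) - r + n).toNat = R + t := by omega
    have e4 : (m : ℤ) - r = ((R + t : ℕ) : ℤ) - n := by push_cast; linarith
    have hS : qPoch q (-(q ^ (-(m : ℤ))) * x) r =
        ∏ l ∈ range r, (1 + q ^ (-(m : ℤ) - 1) * (x * q) * q ^ l) := by
      refine prod_congr rfl fun l _ => ?_
      rw [zpow_sub_one₀ hq0]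
      field_simp
      ring
    have hQ := zpow_mul_qPoch_eq_prodQ (q := q) hx0 Λ n (R + t)
    rw [← e4, prodQ_add hq0 hΛ0 x m n R t r h] at hQ
    rw [Nat.add_sub_cancel_left, e1, vBasis, e2, e3, hS]
    push_cast at hH ⊢
    rw [rWV_eq hq0 hd0 hΛ0, ← hH]
    set E := ((m : ℤ) - r) * ((m : ℤ) - r + 1) / 2 with hE
    have hE2 := two_mul_ediv_two_mul_succ ((m : ℤ) - r)
    rw [← hE] at hE2
    have hqe : q ^ (tri t - t * (t + r)) * q ^ (((m : ℤ) + 1) * t) *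
        q ^ (-(((t : ℤ) + r - m - 1) * r)) * q ^ ((m : ℤ) - r) * q ^ (-E) *
        q ^ (-(((t : ℤ) + r - m) * t)) =
        q ^ ((m : ℤ) * (t + r) - tri m) * q ^ (-tri (t + r + 1)) *
          q ^ (-(((t : ℤ) + r - m - 1) * (t + r))) := by
      simp only [← zpow_add₀ hq0]
      congr 1
      have h1 := two_mul_tri t
      have h3 := two_mul_tri m
      have h4 := two_mul_tri (t + r + 1)
      push_cast at h4
      linarith
    have hde : Λ ^ t * (d₄ * Λ) ^ (-(t : ℤ)) * Λ ^ (-((m : ℤ) - r + n)) * Λ ^ t *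
        d₄ ^ (-(r : ℤ)) = d₄ ^ (-((t : ℤ) + r)) * Λ ^ (-((m : ℤ) + n)) * Λ ^ (t + r) := by
      rw [show -((m : ℤ) - r + n) = -((m : ℤ) + n) + r by ring, zpow_add₀ hΛ0, neg_add (t : ℤ) r,
        zpow_add₀ hd0]
      simp only [zpow_neg, zpow_natCast, mul_pow]
      field_simp
      ring
    have hs1 : (-1 : F) ^ t * (-1) ^ t = 1 := by
      rw [← mul_pow]
      norm_num
    rw [mul_inv, mul_inv, inv_inv, ← zpow_neg]
    simp only [expansionTerm]
    set C := qPoch q q (t + r) / (qPoch q q t * qPoch q q r)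
    set C₁ := ∏ l ∈ range t, (q ^ l - d₄ * Λ * q ^ (-(m : ℤ) - 1))
    set C₂ := ∏ l ∈ range r, (d₄ * Λ * (q ^ ((t : ℤ) + r - m - 1) * Λ⁻¹) - q ^ (t + l))
    set G₁ := ∏ l ∈ range t, (1 * q ^ l + q ^ ((t : ℤ) + r - m - 1) * Λ⁻¹ * (x * q))
    set G₂ := ∏ l ∈ range r, (1 + q ^ (-(m : ℤ) - 1) * (x * q) * q ^ l)
    set V := qPoch q (-(q ^ (-(n : ℤ))) * Λ / x) (R + t)
    calc _ = (q ^ (tri t - t * (t + r)) * q ^ (((m : ℤ) + 1) * t) *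
          q ^ (-(((t : ℤ) + r - m - 1) * r)) * q ^ ((m : ℤ) - r) * q ^ (-E)) *
          (Λ ^ t * (d₄ * Λ) ^ (-(t : ℤ)) * Λ ^ (-((m : ℤ) - r + n)) * d₄ ^ (-(r : ℤ))) *
          ((-1 : F) ^ t * (-1) ^ t) * (x ^ ((m : ℤ) - r) * V) * (C * C₁ * C₂ * G₂ * H⁻¹) := by
          ring
      _ = (q ^ (tri t - t * (t + r)) * q ^ (((m : ℤ) + 1) * t) *
          q ^ (-(((t : ℤ) + r - m - 1) * r)) * q ^ ((m : ℤ) - r) * q ^ (-E) *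
          q ^ (-(((t : ℤ) + r - m) * t))) *
          (Λ ^ t * (d₄ * Λ) ^ (-(t : ℤ)) * Λ ^ (-((m : ℤ) - r + n)) * Λ ^ t *
            d₄ ^ (-(r : ℤ))) *
          (x ^ (-(n : ℤ)) * prodQ q Λ x n R * C * C₁ * C₂ * G₁ * G₂ * H⁻¹) := by
          rw [hs1, hQ]
          ring
      _ = _ := by
          rw [hqe, hde]
          ring
  have hD0 : q ^ (((K : ℤ) - m - 1) * K) * (Λ ^ K)⁻¹ * H ≠ 0 :=
    mul_ne_zero (mul_ne_zero (zpow_ne_zero _ hq0) (inv_ne_zero (pow_ne_zero _ hΛ0))) hH0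
  have hT := zpow_ne_zero (tri (K + 1)) hq0
  rw [sum_congr rfl hterm, ← mul_sum, ← core, hD, hP, wBasis, zpow_neg q (tri (K + 1))]
  rw [mul_assoc _ (_ * H)⁻¹, inv_mul_cancel_left₀ hD0, mul_assoc _ (q ^ tri (K + 1))⁻¹,
    inv_mul_cancel_left₀ hT]
  ring

lemma sum_Icc_int_eq_sum_range {M : Type*} [AddCommMonoid M] (f : ℤ → M) (a b : ℤ) (p : ℕ)
    (h : b = a + p) : ∑ k ∈ Icc a b, f k = ∑ s ∈ range (p + 1), f (a + s) := by
  subst h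
  refine (sum_bij (fun (s : ℕ) _ => a + (s : ℤ)) ?_ ?_ ?_ ?_).symm
  · intro s hs
    rw [mem_range] at hs
    rw [mem_Icc]
    omega
  · intro s _ t _ hst
    omega
  · intro k hk
    rw [mem_Icc] at hk
    exact ⟨(k - a).toNat, by rw [mem_range]; omega, by omega⟩
  · intro s _
    rfl

/-- The `R`-matrix relation over a field in which `q` is not a root of unity and neither `d₄` nor
`Λ` is a power of `q`. -/
theorem rMat_relation {q d₄ Λ x : F} (hq0 : q ≠ 0)
    (hq : ∀ l : ℕ, 1 - q ^ (l + 1) ≠ 0) (hd0 : d₄ ≠ 0) (hΛ0 : Λ ≠ 0) (hx0 : x ≠ 0)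
    (hd : ∀ z : ℤ, 1 - d₄ * q ^ z ≠ 0) (hΛ : ∀ z : ℤ, 1 - Λ * q ^ z ≠ 0) (d₁ : F) (m n : ℕ)
    (i : ℤ) (hi₁ : -(n : ℤ) ≤ i) (hi₂ : i ≤ (m : ℤ)) :
    q ^ (i * (i + 1) / 2) * x ^ i *
        qPoch q (-d₁ * q ^ (i - (m : ℤ)) * x) ((m : ℤ) - i).toNat *
        qPoch q (-d₄ * q ^ (-i - (n : ℤ)) * Λ / x) (i + (n : ℤ)).toNat =
      ∑ j ∈ Finset.Icc (-(n : ℤ)) (m : ℤ),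
        rMat q d₁ d₄ Λ m n i j * q ^ (-(j * (j + 1) / 2)) * x ^ j *
          qPoch q (-(q ^ (-(m : ℤ))) * x) ((m : ℤ) - j).toNat *
          qPoch q (-(q ^ (-(n : ℤ))) * Λ / x) (j + (n : ℤ)).toNat := by
  have hR : ∀ j ∈ Icc (-(n : ℤ)) (m : ℤ),
      rMat q d₁ d₄ Λ m n i j * q ^ (-(j * (j + 1) / 2)) * x ^ j *
          qPoch q (-(q ^ (-(m : ℤ))) * x) ((m : ℤ) - j).toNat *
          qPoch q (-(q ^ (-(n : ℤ))) * Λ / x) (j + (n : ℤ)).toNat =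
      q ^ (-(i * (n : ℤ))) * (Λ * d₄) ^ (i + (n : ℤ)) *
        ∑ k ∈ Icc (max i ((m : ℤ) - (n : ℤ) - j)) (m : ℤ),
          rUW q d₁ d₄ Λ m n i k * (rWV q d₄ Λ m n k j * vBasis q Λ x m n j) := by
    intro j _
    simp only [← mul_assoc]
    rw [rMat, vBasis, ← sum_mul]
    ring
  rw [sum_congr rfl hR, ← mul_sum, sum_comm' (s' := fun k => Icc ((m : ℤ) - n - k) (m : ℤ))
    (t' := Icc i (m : ℤ)) (by
      intro j k
      simp only [mem_Icc, max_le_iff]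
      omega)]
  obtain ⟨I, hI⟩ := Int.eq_ofNat_of_zero_le (show 0 ≤ i + n by omega)
  obtain ⟨p, hp⟩ := Int.eq_ofNat_of_zero_le (show 0 ≤ (m : ℤ) - i by omega)
  obtain rfl : i = (I : ℤ) - n := by omega
  have e1 : (I : ℤ) - n - m = -(p : ℤ) := by omega
  have e2 : -((I : ℤ) - n) - n = -(I : ℤ) := by ring
  have e3 : (I : ℤ) - n + n = I := by ring
  have hIp : I + p = m + n := by omega
  rw [e1, e2, e3, hp, Int.toNat_natCast, Int.toNat_natCast,
    lhs_eq_sum_rUW_mul_wBasis hq0 hq hd0 hΛ0 hx0 hd d₁ m n I p hIp,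
    sum_Icc_int_eq_sum_range _ _ _ p (by omega)]
  congr 1
  refine sum_congr rfl fun s hs => ?_
  have hs := mem_range.1 hs
  rw [← mul_sum, sum_Icc_int_eq_sum_range _ _ _ (I + s) (by push_cast; ring),
    wBasis_eq_sum_rWV_mul_vBasis hq0 hq hd0 hΛ0 hx0 hΛ m n (I + s) (p - s) (by omega)]
  congr 1
  refine sum_congr rfl fun t _ => ?_
  have e4 : ((I + s : ℕ) : ℤ) - n = (I : ℤ) - n + s := by push_cast; ring
  have e5 : (m : ℤ) - (I + s : ℕ) + t = (m : ℤ) - n - ((I : ℤ) - n + s) + t := by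
    push_cast; ring
  rw [e4, e5]

end BasisChange

section Generic

open MvPolynomial

lemma one_sub_algebraMap_X_pow_ne_zero {σ : Type*} (a : σ) (l : ℕ) :
    1 - algebraMap (MvPolynomial σ ℚ) (FractionRing (MvPolynomial σ ℚ)) (X a) ^ (l + 1) ≠ 0 := by
  rw [← map_pow, ← map_one (algebraMap (MvPolynomial σ ℚ) _), ← map_sub]
  refine (map_ne_zero_iff _ (IsFractionRing.injective _ _)).2 fun h => ?_
  simpa using congrArg (eval (0 : σ → ℚ)) h

lemma one_sub_algebraMap_X_mul_zpow_ne_zero {σ : Type*} {a b : σ} (hab : a ≠ b) (z : ℤ) :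
    1 - algebraMap (MvPolynomial σ ℚ) (FractionRing (MvPolynomial σ ℚ)) (X b) *
      algebraMap (MvPolynomial σ ℚ) (FractionRing (MvPolynomial σ ℚ)) (X a) ^ z ≠ 0 := by
  classical
  set φ := algebraMap (MvPolynomial σ ℚ) (FractionRing (MvPolynomial σ ℚ))
  have hφ : Function.Injective φ := IsFractionRing.injective _ _
  have ha : φ (X a) ≠ 0 := (map_ne_zero_iff _ hφ).2 (X_ne_zero a)
  intro h
  have key : φ (X a ^ (-z).toNat) = φ (X b * X a ^ z.toNat) := by
    have hz : φ (X a) ^ z = φ (X a) ^ z.toNat / φ (X a) ^ (-z).toNat := by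
      rw [← zpow_natCast, ← zpow_natCast, ← zpow_sub₀ ha]
      congr 1
      omega
    rw [hz] at h
    rw [map_mul, map_pow, map_pow]
    field_simp at h
    linear_combination h
  simpa [hab.symm] using congrArg (eval fun c => if c = a then (1 : ℚ) else 0) (hφ key)

end Generic

/-- the defining relation (q-6j / R-matrix relation) of Theorem 2.2:
`q^{i(i+1)/2} x^i (-d₁q^{i-m}x;q)_{m-i} (-d₄q^{-i-n}Λ/x;q)_{i+n}
 = Σ_{j=-n}^{m} r_{i,j}(Λ) q^{-j(j+1)/2} x^j (-q^{-m}x;q)_{m-j} (-q^{-n}Λ/x;q)_{j+n}`. -/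
theorem statement3
    (q d₁ d₄ Λ x : F3)
    (hq : q = algebraMap (MvPolynomial (Fin 5) ℚ) F3 (MvPolynomial.X 0))
    (hd₁ : d₁ = algebraMap (MvPolynomial (Fin 5) ℚ) F3 (MvPolynomial.X 1))
    (hd₄ : d₄ = algebraMap (MvPolynomial (Fin 5) ℚ) F3 (MvPolynomial.X 2))
    (hΛ : Λ = algebraMap (MvPolynomial (Fin 5) ℚ) F3 (MvPolynomial.X 3))
    (hx : x = algebraMap (MvPolynomial (Fin 5) ℚ) F3 (MvPolynomial.X 4))
    (m n : ℕ) (i : ℤ) (hi₁ : -(n : ℤ) ≤ i) (hi₂ : i ≤ (m : ℤ)) :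
    q ^ (i * (i + 1) / 2) * x ^ i *
        qPoch q (-d₁ * q ^ (i - (m : ℤ)) * x) ((m : ℤ) - i).toNat *
        qPoch q (-d₄ * q ^ (-i - (n : ℤ)) * Λ / x) (i + (n : ℤ)).toNat =
      ∑ j ∈ Finset.Icc (-(n : ℤ)) (m : ℤ),
        rMat q d₁ d₄ Λ m n i j * q ^ (-(j * (j + 1) / 2)) * x ^ j *
          qPoch q (-(q ^ (-(m : ℤ))) * x) ((m : ℤ) - j).toNat *
          qPoch q (-(q ^ (-(n : ℤ))) * Λ / x) (j + (n : ℤ)).toNat := by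
  subst hq hd₁ hd₄ hΛ hx
  have h0 : ∀ a : Fin 5, algebraMap (MvPolynomial (Fin 5) ℚ) F3 (MvPolynomial.X a) ≠ 0 := fun a =>
    (map_ne_zero_iff _ (IsFractionRing.injective _ _)).2 (MvPolynomial.X_ne_zero a)
  exact rMat_relation (h0 0) (one_sub_algebraMap_X_pow_ne_zero 0) (h0 2) (h0 3) (h0 4)
    (one_sub_algebraMap_X_mul_zpow_ne_zero (by decide))
    (one_sub_algebraMap_X_mul_zpow_ne_zero (by decide)) _ m n i hi₁ hi₂
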